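/- Data processing inequality for KL divergence on finite spaces: let X and Y be finite nonempty types, let p and q be probability mass functions on X with q(x) > 0 whenever p(x) > 0, and let K(·|x) be a probability mass function on Y for each x ∈ X (a Markov kernel). Define the pushforward pmfs (pK)(y) = Σ_x p(x)·K(y|x) and (qK)(y) = Σ_x q(x)·K(y|x). Then D_KL(pK ‖ qK) ≤ D_KL(p ‖ q). -/

import Mathlib

/-- Kullback–Leibler divergence between two pmfs on a finite type,
`D_KL(p‖q) = ∑_{x : p x > 0} p x * log (p x / q x)`. -/
noncomputable def klDiv {X : Type*} [Fintype X] (p q : X → ℝ) : ℝ :=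
  ∑ x, if 0 < p x then p x * Real.log (p x / q x) else 0

/-- The summands of `klDiv` with `p x = 0` vanish, so the case split can be dropped. -/
theorem klDiv_eq_sum {X : Type*} [Fintype X] {p : X → ℝ} (q : X → ℝ) (hp0 : ∀ x, 0 ≤ p x) :
    klDiv p q = ∑ x, p x * Real.log (p x / q x) := by
  refine Finset.sum_congr rfl fun x _ => ?_
  split_ifs with h
  · rfl
  · simp [le_antisymm (not_lt.mp h) (hp0 x)]

/-- The log-sum inequality. -/
theorem sum_mul_log_sum_div_sum_le {ι : Type*} (s : Finset ι) (a b : ι → ℝ)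
    (ha : ∀ i ∈ s, 0 ≤ a i) (hb : ∀ i ∈ s, 0 ≤ b i) (hab : ∀ i ∈ s, 0 < a i → 0 < b i) :
    (∑ i ∈ s, a i) * Real.log ((∑ i ∈ s, a i) / ∑ i ∈ s, b i)
      ≤ ∑ i ∈ s, a i * Real.log (a i / b i) := by
  rcases (Finset.sum_nonneg ha).eq_or_lt with hA | hA
  · have h := (Finset.sum_eq_zero_iff_of_nonneg ha).mp hA.symm
    rw [← hA, zero_mul, Finset.sum_eq_zero fun i hi => by rw [h i hi, zero_mul]]
  obtain ⟨j, hj, haj⟩ : ∃ j ∈ s, 0 < a j :=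
    Finset.exists_lt_of_sum_lt (by simpa using hA)
  have hB : 0 < ∑ i ∈ s, b i := Finset.sum_pos' hb ⟨j, hj, hab j hj haj⟩
  set A := ∑ i ∈ s, a i with hAdef
  set B := ∑ i ∈ s, b i with hBdef
  have key : ∀ i ∈ s, a i * Real.log (A / B) + (a i - b i * (A / B))
      ≤ a i * Real.log (a i / b i) := by
    intro i hi
    rcases (ha i hi).eq_or_lt with h | h
    · rw [← h]
      have := mul_nonneg (hb i hi) (div_pos hA hB).le
      linarith
    · have hbi := hab i hi h
      have h1 := Real.one_sub_inv_le_log_of_pos (div_pos (div_pos h hbi) (div_pos hA hB))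
      rw [Real.log_div (div_pos h hbi).ne' (div_pos hA hB).ne'] at h1
      have h2 := mul_le_mul_of_nonneg_left h1 h.le
      have h3 : a i * (1 - (a i / b i / (A / B))⁻¹) = a i - b i * (A / B) := by
        field_simp
      linarith
  calc A * Real.log (A / B)
      = ∑ i ∈ s, (a i * Real.log (A / B) + (a i - b i * (A / B))) := by
        rw [Finset.sum_add_distrib, Finset.sum_sub_distrib, ← Finset.sum_mul, ← Finset.sum_mul,
          ← hAdef, ← hBdef, mul_div_cancel₀ A hB.ne']
        ring
    _ ≤ _ := Finset.sum_le_sum key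

/-- Data processing inequality for KL divergence on finite spaces:
for pmfs `p, q` on `X` with `q(x) > 0` whenever `p(x) > 0`, and a Markov kernel
`K(·|x)` from `X` to `Y`, the pushforward pmfs `(pK)(y) = ∑_x p(x)·K(y|x)` and
`(qK)(y) = ∑_x q(x)·K(y|x)` satisfy `D_KL(pK ‖ qK) ≤ D_KL(p ‖ q)`. -/
theorem kl_data_processing_inequality
    {X Y : Type*} [Fintype X] [Fintype Y] [Nonempty X] [Nonempty Y]
    (p q : X → ℝ)
    (hp0 : ∀ x, 0 ≤ p x) (hp1 : ∑ x, p x = 1)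
    (hq0 : ∀ x, 0 ≤ q x) (hq1 : ∑ x, q x = 1)
    (hac : ∀ x, 0 < p x → 0 < q x)
    (K : Y → X → ℝ)
    (hK0 : ∀ y x, 0 ≤ K y x) (hK1 : ∀ x, ∑ y, K y x = 1) :
    klDiv (fun y => ∑ x, p x * K y x) (fun y => ∑ x, q x * K y x)
      ≤ klDiv p q := by
  have hpK : ∀ y x, 0 ≤ p x * K y x := fun y x => mul_nonneg (hp0 x) (hK0 y x)
  rw [klDiv_eq_sum _ fun y => Finset.sum_nonneg fun x _ => hpK y x, klDiv_eq_sum _ hp0]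
  calc ∑ y, (∑ x, p x * K y x) * Real.log ((∑ x, p x * K y x) / ∑ x, q x * K y x)
      ≤ ∑ y, ∑ x, p x * K y x * Real.log (p x * K y x / (q x * K y x)) := by
        refine Finset.sum_le_sum fun y _ => sum_mul_log_sum_div_sum_le _ _ _
          (fun x _ => hpK y x) (fun x _ => mul_nonneg (hq0 x) (hK0 y x)) fun x _ h => ?_
        exact mul_pos (hac x (pos_of_mul_pos_left h (hK0 y x)))
          (pos_of_mul_pos_right h (hp0 x))
    _ = ∑ y, ∑ x, K y x * (p x * Real.log (p x / q x)) := by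
        refine Finset.sum_congr rfl fun y _ => Finset.sum_congr rfl fun x _ => ?_
        rcases eq_or_ne (K y x) 0 with h | h
        · simp [h]
        · rw [mul_div_mul_right _ _ h]
          ring
    _ = ∑ x, p x * Real.log (p x / q x) := by
        rw [Finset.sum_comm]
        simp_rw [← Finset.sum_mul, hK1, one_mul]
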